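/- arXiv:1705.01720 — 3 statements merged into one kernel-verified Lean document; each statement's English description precedes it below -/
import Mathlib

section
/- Let x ∈ ℝ^n and let S₀ ⊆ ℝ^n be a finite set with ⟨h,x⟩ = 0 for all h ∈ S₀. If |S₀| > n, then there exists h ∈ S₀ such that S₀ ∖ {h} infers h at x (with inferred value 0). -/
open Finset

namespace LDT

/-- The standard inner product on `ℝ^n`. -/
def ip {n : ℕ} (x h : Fin n → ℝ) : ℝ := ∑ i, x i * h i

/-- `S` infers `h` at `x`: the sign of `⟨x,h⟩` is determined by the signs of `⟨x,v⟩` for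
`v ∈ S ∪ (S - S)`, i.e. every `x'` with the same sign pattern as `x` on `S ∪ (S-S)` gives the
same sign on `h`. -/
def Infers {n : ℕ} (S : Finset (Fin n → ℝ)) (x h : Fin n → ℝ) : Prop :=
  ∀ x' : Fin n → ℝ,
    (∀ v ∈ S, SignType.sign (ip x' v) = SignType.sign (ip x v)) →
    (∀ v ∈ S, ∀ w ∈ S, SignType.sign (ip x' (v - w)) = SignType.sign (ip x (v - w))) →
    SignType.sign (ip x' h) = SignType.sign (ip x h)

/-- `H` has inference dimension at most `d`: every subset `S ⊆ H` of size at least `d` contains,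
for every `x`, an element `h` inferred by `S \ {h}` at `x`. -/
def InfProp {n : ℕ} (H : Finset (Fin n → ℝ)) (d : ℕ) : Prop :=
  ∀ S ⊆ H, d ≤ S.card → ∀ x : Fin n → ℝ, ∃ h ∈ S, Infers (S.erase h) x h

theorem ip_eq_dotProduct {n : ℕ} (x h : Fin n → ℝ) : ip x h = x ⬝ᵥ h := rfl

/-- If `y` is orthogonal to every vector of a linear relation but one, whose coefficient is
nonzero, then it is orthogonal to that one too. -/
theorem ip_eq_zero_of_relation {n : ℕ} {S : Finset (Fin n → ℝ)} {f : (Fin n → ℝ) → ℝ}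
    (hf : ∑ v ∈ S, f v • v = 0) {h : Fin n → ℝ} (hS : h ∈ S) (hfh : f h ≠ 0) {y : Fin n → ℝ}
    (hy : ∀ v ∈ S.erase h, ip y v = 0) : ip y h = 0 := by
  have key : ∑ v ∈ S, f v * ip y v = 0 := by
    simpa [dotProduct_sum, ip_eq_dotProduct] using congrArg (fun v => y ⬝ᵥ v) hf
  rw [← Finset.add_sum_erase S _ hS,
    Finset.sum_eq_zero fun v hv => by rw [hy v hv, mul_zero], add_zero] at key
  exact (mul_eq_zero.mp key).resolve_left hfh

/-- Claim 3.1: if `S₀ ⊆ ℝ^n` is a finite set with `⟨h,x⟩ = 0` for all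
`h ∈ S₀` and `|S₀| > n`, then some `h ∈ S₀` is inferred by `S₀ \ {h}` at `x`, with inferred
value `0`. -/
theorem infer_from_zeros {n : ℕ} (x : Fin n → ℝ) (S₀ : Finset (Fin n → ℝ))
    (hzero : ∀ h ∈ S₀, ip x h = 0) (hcard : n < S₀.card) :
    ∃ h ∈ S₀, Infers (S₀.erase h) x h ∧ SignType.sign (ip x h) = 0 := by
  obtain ⟨f, hf, h, hS, hfh⟩ :=
    Module.exists_nontrivial_relation_of_finrank_lt_card (R := ℝ) (t := S₀) (by simpa using hcard)
  refine ⟨h, hS, fun y hy _ => ?_, by rw [hzero h hS, sign_zero]⟩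
  rw [hzero h hS, ip_eq_zero_of_relation hf hS hfh fun v hv => ?_]
  have hsign := hy v hv
  rwa [hzero v (Finset.mem_of_mem_erase hv), sign_zero, sign_eq_zero_iff] at hsign

end LDT
end

section
/- Let x ∈ ℝ^n and h₁, …, h_{p+1} ∈ ℝ^n with p ≥ 1 be such that (i) 0 < ⟨h₁,x⟩ ≤ ⟨h₂,x⟩ ≤ … ≤ ⟨h_p,x⟩, and (ii) h_{p+1} − h₁ = Σ_{i=1}^{p−1} β_i (h_{i+1} − h_i) for some nonnegative reals β_i ≥ 0. Then ⟨h_{p+1},x⟩ ≥ ⟨h₁,x⟩ > 0, and moreover the set R = {h₁, …, h_p} infers h_{p+1} at x with inferred value +. -/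
open Finset

namespace LDT

open scoped Classical

theorem ip_sub {n : ℕ} (x v w : Fin n → ℝ) : ip x (v - w) = ip x v - ip x w :=
  dotProduct_sub x v w

theorem ip_sum_smul {n : ℕ} {ι : Type*} (x : Fin n → ℝ) (s : Finset ι) (β : ι → ℝ)
    (v : ι → Fin n → ℝ) : ip x (∑ i ∈ s, β i • v i) = ∑ i ∈ s, β i * ip x (v i) := by
  change x ⬝ᵥ _ = ∑ i ∈ s, β i * (x ⬝ᵥ v i)
  simp [dotProduct_sum, dotProduct_smul]

/-- A vector lying in a cone with apex `u` pairs with `x` at least as much as `u` does, provided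
the generators of the cone pair nonnegatively with `x`. -/
theorem ip_le_of_sub_eq_sum {n : ℕ} {ι : Type*} {x u w : Fin n → ℝ} {s : Finset ι} {β : ι → ℝ}
    {v : ι → Fin n → ℝ} (hβ : ∀ i ∈ s, 0 ≤ β i) (hv : ∀ i ∈ s, 0 ≤ ip x (v i))
    (hw : w - u = ∑ i ∈ s, β i • v i) : ip x u ≤ ip x w := by
  rw [← sub_nonneg, ← ip_sub, hw, ip_sum_smul]
  exact Finset.sum_nonneg fun i hi => mul_nonneg (hβ i hi) (hv i hi)

/-- cone inference step: if `0 < ⟨h 1, x⟩ ≤ ⟨h 2, x⟩ ≤ … ≤ ⟨h p, x⟩` and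
`h (p+1) - h 1 = ∑_{i=1}^{p-1} β i • (h (i+1) - h i)` with all `β i ≥ 0`, then
`⟨h (p+1), x⟩ ≥ ⟨h 1, x⟩ > 0`, and `R = {h 1, …, h p}` infers `h (p+1)` at `x` with inferred
value `+`. -/
theorem cone_inference {n : ℕ} (x : Fin n → ℝ) (p : ℕ) (hp : 1 ≤ p)
    (h : ℕ → Fin n → ℝ) (β : ℕ → ℝ)
    (hpos : 0 < ip x (h 1))
    (hmono : ∀ i, 1 ≤ i → i < p → ip x (h i) ≤ ip x (h (i + 1)))
    (hβ : ∀ i, 0 ≤ β i)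
    (hcone : h (p + 1) - h 1 = ∑ i ∈ Finset.Icc 1 (p - 1), β i • (h (i + 1) - h i)) :
    (ip x (h 1) ≤ ip x (h (p + 1)) ∧ 0 < ip x (h 1)) ∧
    Infers ((Finset.Icc 1 p).image h) x (h (p + 1)) ∧
    SignType.sign (ip x (h (p + 1))) = 1 := by
  have hdiff : ∀ i ∈ Finset.Icc 1 (p - 1), 0 ≤ ip x (h (i + 1) - h i) := fun i hi => by
    rw [Finset.mem_Icc] at hi
    rw [ip_sub, sub_nonneg]
    exact hmono i hi.1 (by omega)
  have hle : ip x (h 1) ≤ ip x (h (p + 1)) :=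
    ip_le_of_sub_eq_sum (fun i _ => hβ i) hdiff hcone
  have hsign : SignType.sign (ip x (h (p + 1))) = 1 := sign_pos (hpos.trans_le hle)
  refine ⟨⟨hle, hpos⟩, fun x' hS hSS => ?_, hsign⟩
  have hmem : ∀ i, 1 ≤ i → i ≤ p → h i ∈ (Finset.Icc 1 p).image h := fun i h1 h2 =>
    Finset.mem_image_of_mem h (Finset.mem_Icc.2 ⟨h1, h2⟩)
  have hpos' : 0 < ip x' (h 1) := by
    rw [← sign_eq_one_iff, hS _ (hmem 1 le_rfl hp), sign_eq_one_iff]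
    exact hpos
  have hle' : ip x' (h 1) ≤ ip x' (h (p + 1)) := by
    refine ip_le_of_sub_eq_sum (fun i _ => hβ i) (fun i hi => ?_) hcone
    have hi' := Finset.mem_Icc.1 hi
    rw [← sign_nonneg_iff, hSS _ (hmem (i + 1) (by omega) (by omega)) _
      (hmem i hi'.1 (by omega)), sign_nonneg_iff]
    exact hdiff i hi
  rw [hsign]
  exact sign_pos (hpos'.trans_le hle')

end LDT
end

section
/- Let H ⊆ ℝ^n be a finite set with inference dimension d, and suppose 2d ≤ |H|. Then for every x ∈ ℝ^n, the average of |infer(S,x) ∩ H| over all subsets S ⊆ H of size |S| = 2d is at least |H|/2; that is, Σ_{S ⊆ H, |S|=2d} |infer(S,x) ∩ H| ≥ (|H|/2)·binomial(|H|, 2d). -/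
open Finset

namespace LDT

open scoped Classical

theorem Infers.mono {n : ℕ} {S T : Finset (Fin n → ℝ)} {x h : Fin n → ℝ} (hST : S ⊆ T)
    (hS : Infers S x h) : Infers T x h :=
  fun x' h₁ h₂ => hS x' (fun v hv => h₁ v (hST hv))
    (fun v hv w hw => h₂ v (hST hv) w (hST hw))

theorem infers_of_mem {n : ℕ} {S : Finset (Fin n → ℝ)} {h : Fin n → ℝ} (hh : h ∈ S)
    (x : Fin n → ℝ) : Infers S x h :=
  fun _ h₁ _ => h₁ h hh

/-- Fewer than `d` elements of `T ⊆ H` are not inferred by the other elements of `T`. -/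
theorem InfProp.card_filter_not_infers_lt {n : ℕ} {H : Finset (Fin n → ℝ)} {d : ℕ}
    (hdim : InfProp H d) {T : Finset (Fin n → ℝ)} (hT : T ⊆ H) (x : Fin n → ℝ) :
    (T.filter fun h => ¬ Infers (T.erase h) x h).card < d := by
  by_contra! hcard
  obtain ⟨h, hh, hinf⟩ := hdim _ ((filter_subset _ _).trans hT) hcard x
  exact (mem_filter.1 hh).2 (hinf.mono (erase_subset_erase _ (filter_subset _ _)))

/-- Double counting: choosing a `k`-subset and a point outside it amounts to choosing a
`(k + 1)`-subset and a point in it. -/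
theorem sum_card_filter_sdiff_eq {α : Type*} [DecidableEq α] (H : Finset α) (k : ℕ)
    (p : Finset α → α → Prop) :
    ∑ S ∈ H.powersetCard k, ((H \ S).filter fun h => p S h).card =
      ∑ T ∈ H.powersetCard (k + 1), (T.filter fun h => p (T.erase h) h).card := by
  rw [← card_sigma, ← card_sigma]
  refine card_nbij' (fun a => ⟨insert a.2 a.1, a.2⟩) (fun a => ⟨a.1.erase a.2, a.2⟩) ?_ ?_ ?_ ?_
  · rintro ⟨S, h⟩ ha
    simp only [coe_sigma, Set.mem_sigma_iff, mem_coe, mem_powersetCard, mem_filter,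
      mem_sdiff] at ha ⊢
    obtain ⟨⟨hS, hk⟩, ⟨hh, hn⟩, hp⟩ := ha
    refine ⟨⟨insert_subset hh hS, by rw [card_insert_of_notMem hn, hk]⟩, mem_insert_self _ _, ?_⟩
    rwa [erase_insert hn]
  · rintro ⟨T, h⟩ ha
    simp only [coe_sigma, Set.mem_sigma_iff, mem_coe, mem_powersetCard, mem_filter,
      mem_sdiff] at ha ⊢
    obtain ⟨⟨hT, hk⟩, hh, hp⟩ := ha
    exact ⟨⟨(erase_subset _ _).trans hT, by rw [card_erase_of_mem hh, hk, Nat.add_sub_cancel]⟩,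
      ⟨hT hh, notMem_erase _ _⟩, hp⟩
  · rintro ⟨S, h⟩ ha
    simp only [coe_sigma, Set.mem_sigma_iff, mem_coe, mem_filter, mem_sdiff] at ha
    simp [erase_insert ha.2.1.2]
  · rintro ⟨T, h⟩ ha
    simp only [coe_sigma, Set.mem_sigma_iff, mem_coe, mem_filter] at ha
    simp [insert_erase ha.2.1]

/-- Lemma 4.2: if `H` has inference dimension `d` and `2d ≤ |H|`, then for
every `x`, the average over subsets `S ⊆ H` of size `2d` of `|infer(S,x) ∩ H|` is at least
`|H|/2`; equivalently `∑_{S} |infer(S,x) ∩ H| ≥ (|H|/2)·C(|H|, 2d)`. -/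
theorem average_inference {n : ℕ} (H : Finset (Fin n → ℝ)) (d : ℕ) (hd : 1 ≤ d)
    (hdim : InfProp H d) (hH : 2 * d ≤ H.card) (x : Fin n → ℝ) :
    ((H.card : ℝ) / 2) * (H.card.choose (2 * d)) ≤
      ∑ S ∈ H.powersetCard (2 * d), ((H.filter (fun h => Infers S x h)).card : ℝ) := by
  have hsplit : ∀ S ∈ H.powersetCard (2 * d), (H.filter fun h => Infers S x h).card =
      2 * d + ((H \ S).filter fun h => Infers S x h).card := by
    intro S hS
    obtain ⟨hSH, hSc⟩ := mem_powersetCard.1 hS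
    conv_lhs => rw [← union_sdiff_of_subset hSH]
    rw [filter_union, card_union_of_disjoint (disjoint_filter_filter disjoint_sdiff),
      filter_true_of_mem fun h hh => infers_of_mem hh x, hSc]
  have hlower : ∀ T ∈ H.powersetCard (2 * d + 1),
      d + 2 ≤ (T.filter fun h => Infers (T.erase h) x h).card := by
    intro T hT
    obtain ⟨hTH, hTc⟩ := mem_powersetCard.1 hT
    have h₁ := hdim.card_filter_not_infers_lt hTH x
    have h₂ := card_filter_add_card_filter_not (s := T) fun h => Infers (T.erase h) x h
    omega
  have hsum : H.card.choose (2 * d) * (2 * d) + H.card.choose (2 * d + 1) * (d + 2) ≤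
      ∑ S ∈ H.powersetCard (2 * d), (H.filter fun h => Infers S x h).card := by
    rw [sum_congr rfl hsplit, sum_add_distrib,
      sum_card_filter_sdiff_eq H (2 * d) fun S h => Infers S x h, sum_const, card_powersetCard,
      smul_eq_mul, ← card_powersetCard (2 * d + 1) H, ← smul_eq_mul (a := (powersetCard _ H).card)]
    exact Nat.add_le_add_left (card_nsmul_le_sum _ _ _ hlower) _
  have hchoose := Nat.choose_succ_right_eq H.card (2 * d)
  obtain ⟨m, hm⟩ := Nat.exists_eq_add_of_le hH
  rw [← Nat.cast_sum]
  have hsum' : ((H.card.choose (2 * d) * (2 * d) + H.card.choose (2 * d + 1) * (d + 2) : ℕ) : ℝ) ≤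
      ((∑ S ∈ H.powersetCard (2 * d), (H.filter fun h => Infers S x h).card : ℕ) : ℝ) :=
    Nat.cast_le.2 hsum
  refine le_trans ?_ hsum'
  rw [hm, Nat.add_sub_cancel_left] at hchoose
  rw [hm]
  have hchoose' : ((2 * d + m).choose (2 * d + 1) : ℝ) * (2 * d + 1) =
      (2 * d + m).choose (2 * d) * m := by
    exact_mod_cast hchoose
  push_cast
  have h₁ : (0 : ℝ) ≤ (2 * d + m).choose (2 * d + 1) := Nat.cast_nonneg _
  have h₂ : (0 : ℝ) ≤ (2 * d + m).choose (2 * d) * (d : ℝ) := by positivity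
  linarith

end LDT
end
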